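/- Let 1 < p < ∞. If φ(z) = Σ_{k≥0} φ_k z^k ∈ 𝓜_p and all the coefficients φ_k are nonnegative real numbers, then φ ∈ ℓ¹_A and ‖φ‖_1 = ‖φ‖_{𝓜_p}. -/

import Mathlib

open ComplexConjugate
open scoped ENNReal

noncomputable section

/-- Cauchy product of coefficient sequences (multiplication of power series). -/
def cauchyMul (f g : ℕ → ℂ) : ℕ → ℂ :=
  fun n => ∑ k ∈ Finset.range (n + 1), f k * g (n - k)

/-- Membership in `ℓᵖ_A`: the coefficient sequence is `p`-summable (`p` finite). -/
def MemLpA (p : ℝ) (f : ℕ → ℂ) : Prop :=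
  Summable fun k => ‖f k‖ ^ p

/-- The `ℓᵖ` norm of a coefficient sequence (`p` finite). -/
def pNorm (p : ℝ) (f : ℕ → ℂ) : ℝ :=
  (∑' k, ‖f k‖ ^ p) ^ (1 / p)

/-- `φ` is a multiplier of `ℓᵖ_A`. -/
def IsMultiplier (p : ℝ) (φ : ℕ → ℂ) : Prop :=
  ∀ f : ℕ → ℂ, MemLpA p f → MemLpA p (cauchyMul φ f)

/-- The multiplier norm of `φ`, i.e. the operator norm of multiplication by `φ` on `ℓᵖ_A`. -/
def multNorm (p : ℝ) (φ : ℕ → ℂ) : ℝ :=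
  sSup { x : ℝ | ∃ f : ℕ → ℂ, MemLpA p f ∧ pNorm p f ≤ 1 ∧ x = pNorm p (cauchyMul φ f) }

theorem pNorm_nonneg (p : ℝ) (f : ℕ → ℂ) : 0 ≤ pNorm p f :=
  Real.rpow_nonneg (tsum_nonneg fun _ => Real.rpow_nonneg (norm_nonneg _) _) _

theorem pNorm_rpow {p : ℝ} (hp : 0 < p) (f : ℕ → ℂ) : pNorm p f ^ p = ∑' k, ‖f k‖ ^ p := by
  rw [pNorm, one_div,
    Real.rpow_inv_rpow (tsum_nonneg fun _ => Real.rpow_nonneg (norm_nonneg _) _) hp.ne']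

/-- Young's inequality for the convolution of an `ℓ¹` sequence with an `ℓᵖ` sequence. -/
theorem pNorm_cauchyMul_le {p : ℝ} (hp : 1 < p) {φ f : ℕ → ℂ} (hφ : Summable fun k => ‖φ k‖)
    (hf : MemLpA p f) : pNorm p (cauchyMul φ f) ≤ (∑' k, ‖φ k‖) * pNorm p f := by
  have hp0 : 0 < p := by linarith
  set A := ∑' k, ‖φ k‖ with hA
  have hA0 : 0 ≤ A := tsum_nonneg fun _ => norm_nonneg _
  have hfn : ∀ k, 0 ≤ ‖f k‖ ^ p := fun k => Real.rpow_nonneg (norm_nonneg _) _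
  have hφ' : Summable fun k => ‖‖φ k‖‖ := by simpa using hφ
  have hf' : Summable fun k => ‖‖f k‖ ^ p‖ := hf.norm
  have hconv := summable_norm_sum_mul_range_of_summable_norm hφ' hf'
  have hconv' : Summable fun n => ∑ k ∈ Finset.range (n + 1), ‖φ k‖ * ‖f (n - k)‖ ^ p :=
    hconv.of_norm
  have key : ∀ n, ‖cauchyMul φ f n‖ ^ p ≤
      A ^ (p - 1) * ∑ k ∈ Finset.range (n + 1), ‖φ k‖ * ‖f (n - k)‖ ^ p := by
    intro n
    have h1 : ‖cauchyMul φ f n‖ ≤ ∑ k ∈ Finset.range (n + 1), ‖φ k‖ * ‖f (n - k)‖ := by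
      simpa only [cauchyMul, norm_mul] using
        norm_sum_le (Finset.range (n + 1)) fun k => φ k * f (n - k)
    have h2 := Real.inner_le_weight_mul_Lp_of_nonneg (Finset.range (n + 1)) hp.le
      (fun k => ‖φ k‖) (fun k => ‖f (n - k)‖) (fun _ => norm_nonneg _) (fun _ => norm_nonneg _)
    have hW : 0 ≤ ∑ k ∈ Finset.range (n + 1), ‖φ k‖ := Finset.sum_nonneg fun _ _ => norm_nonneg _
    have hS : 0 ≤ ∑ k ∈ Finset.range (n + 1), ‖φ k‖ * ‖f (n - k)‖ ^ p :=
      Finset.sum_nonneg fun _ _ => mul_nonneg (norm_nonneg _) (hfn _)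
    calc ‖cauchyMul φ f n‖ ^ p
        ≤ ((∑ k ∈ Finset.range (n + 1), ‖φ k‖) ^ (1 - p⁻¹) *
            (∑ k ∈ Finset.range (n + 1), ‖φ k‖ * ‖f (n - k)‖ ^ p) ^ p⁻¹) ^ p :=
          Real.rpow_le_rpow (norm_nonneg _) (h1.trans h2) hp0.le
      _ = (∑ k ∈ Finset.range (n + 1), ‖φ k‖) ^ (p - 1) *
            ∑ k ∈ Finset.range (n + 1), ‖φ k‖ * ‖f (n - k)‖ ^ p := by
          rw [Real.mul_rpow (Real.rpow_nonneg hW _) (Real.rpow_nonneg hS _),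
            Real.rpow_inv_rpow hS hp0.ne', ← Real.rpow_mul hW, sub_mul, one_mul,
            inv_mul_cancel₀ hp0.ne']
      _ ≤ _ := mul_le_mul_of_nonneg_right
          (Real.rpow_le_rpow hW (hφ.sum_le_tsum _ fun _ _ => norm_nonneg _) (by linarith)) hS
  have hsum : ∑' n, ‖cauchyMul φ f n‖ ^ p ≤ A ^ p * ∑' k, ‖f k‖ ^ p := by
    have hmaj := hconv'.mul_left (A ^ (p - 1))
    have hmem : Summable fun n => ‖cauchyMul φ f n‖ ^ p :=
      hmaj.of_nonneg_of_le (fun n => Real.rpow_nonneg (norm_nonneg _) _) key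
    calc ∑' n, ‖cauchyMul φ f n‖ ^ p
        ≤ ∑' n, A ^ (p - 1) * ∑ k ∈ Finset.range (n + 1), ‖φ k‖ * ‖f (n - k)‖ ^ p :=
          hmem.tsum_le_tsum key hmaj
      _ = A ^ (p - 1) * (A * ∑' k, ‖f k‖ ^ p) := by
          rw [tsum_mul_left, hA, tsum_mul_tsum_eq_tsum_sum_range_of_summable_norm hφ' hf']
      _ = A ^ p * ∑' k, ‖f k‖ ^ p := by
          rw [← mul_assoc, ← Real.rpow_add_one' hA0 (by linarith), sub_add_cancel]
  rw [← Real.rpow_le_rpow_iff (pNorm_nonneg _ _) (mul_nonneg hA0 (pNorm_nonneg _ _)) hp0,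
    Real.mul_rpow hA0 (pNorm_nonneg _ _), pNorm_rpow hp0, pNorm_rpow hp0]
  exact hsum

theorem exists_antitone_summable_not_summable_mul {b : ℕ → NNReal}
    (hb : Filter.Tendsto b Filter.atTop Filter.atTop) :
    ∃ g : ℕ → NNReal, Antitone g ∧ Summable g ∧ ¬ Summable fun n => g n * b n := by
  have hM : ∀ j : ℕ, ∃ M : ℕ, 1 ≤ M ∧ ∀ n, M ≤ n → 2 ^ j ≤ b n := by
    intro j
    obtain ⟨M, hM⟩ := Filter.eventually_atTop.1 (hb.eventually_ge_atTop (2 ^ j))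
    exact ⟨max M 1, le_max_right _ _, fun n hn => hM n ((le_max_left _ _).trans hn)⟩
  choose M hM1 hMb using hM
  set w : ℕ → NNReal := fun j => (1 / 2) ^ j / M j
  set F : ℕ → ℕ → ℝ≥0∞ := fun n j => if n < 2 * M j then (w j : ℝ≥0∞) else 0 with hF
  have hsumF : ∀ (j : ℕ) (c : ℕ → ℝ≥0∞),
      ∑' n, F n j * c n = w j * ∑ n ∈ Finset.range (2 * M j), c n := by
    intro j c
    rw [tsum_eq_sum (s := Finset.range (2 * M j)), Finset.mul_sum]
    · refine Finset.sum_congr rfl fun n hn => ?_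
      rw [hF]
      simp only [Finset.mem_range.1 hn, if_true]
    · intro n hn
      have : ¬ n < 2 * M j := by simpa using hn
      simp [hF, this]
  have hMw : ∀ j, w j * M j = (1 / 2) ^ j := fun j =>
    div_mul_cancel₀ _ (Nat.cast_ne_zero.2 (Nat.one_le_iff_ne_zero.1 (hM1 j)))
  have hG : ∑' n, ∑' j, F n j ≠ ⊤ := by
    rw [ENNReal.tsum_comm]
    have : ∀ j, ∑' n, F n j = ((2 * (1 / 2) ^ j : NNReal) : ℝ≥0∞) := by
      intro j
      have h := hsumF j fun _ => 1
      simp only [mul_one, Finset.sum_const, Finset.card_range, nsmul_eq_mul] at h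
      rw [h, ← hMw]
      push_cast
      ring
    simp only [this]
    rw [ENNReal.tsum_coe_ne_top_iff_summable]
    refine Summable.mul_left _ ?_
    rw [← NNReal.summable_coe]
    simpa using summable_geometric_two
  have hGn : ∀ n, ∑' j, F n j ≠ ⊤ := ENNReal.ne_top_of_tsum_ne_top hG
  refine ⟨fun n => (∑' j, F n j).toNNReal, ?_, ?_, ?_⟩
  · intro m n hmn
    refine ENNReal.toNNReal_mono (hGn m) (ENNReal.tsum_le_tsum fun j => ?_)
    simp only [hF]
    split_ifs with h1 h2
    · exact le_rfl
    · omega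
    · exact zero_le
    · exact le_rfl
  · rw [← ENNReal.tsum_coe_ne_top_iff_summable]
    simpa only [ENNReal.coe_toNNReal (hGn _)] using hG
  · rw [← ENNReal.tsum_coe_ne_top_iff_summable, not_not]
    simp only [ENNReal.coe_mul, ENNReal.coe_toNNReal (hGn _), ← ENNReal.tsum_mul_right]
    rw [ENNReal.tsum_comm, eq_top_iff]
    have hone : ∀ j, (1 : ℝ≥0∞) ≤ ∑' n, F n j * b n := by
      intro j
      rw [hsumF]
      have h : (1 : NNReal) ≤ w j * ∑ n ∈ Finset.range (2 * M j), b n := by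
        calc (1 : NNReal) = w j * ∑ n ∈ Finset.Ico (M j) (2 * M j), 2 ^ j := by
              rw [Finset.sum_const, Nat.card_Ico, nsmul_eq_mul, two_mul, Nat.add_sub_cancel,
                ← mul_assoc, hMw, ← mul_pow]
              simp
          _ ≤ w j * ∑ n ∈ Finset.range (2 * M j), b n := by
              gcongr
              refine (Finset.sum_le_sum fun n hn => hMb j n (Finset.mem_Ico.1 hn).1).trans
                (Finset.sum_le_sum_of_subset fun n hn => ?_)
              exact Finset.mem_range.2 (Finset.mem_Ico.1 hn).2
      exact_mod_cast h
    calc (⊤ : ℝ≥0∞) = ∑' _ : ℕ, 1 := by simp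
      _ ≤ _ := ENNReal.tsum_le_tsum hone

theorem mul_sum_le_norm_cauchyMul {φ : ℕ → ℂ} (hφ : ∀ k, φ k = (‖φ k‖ : ℂ)) {h : ℕ → ℝ}
    (hanti : Antitone h) (n : ℕ) :
    h n * ∑ k ∈ Finset.range (n + 1), ‖φ k‖ ≤ ‖cauchyMul φ (fun m => (h m : ℂ)) n‖ := by
  have : cauchyMul φ (fun m => (h m : ℂ)) n =
      ((∑ k ∈ Finset.range (n + 1), ‖φ k‖ * h (n - k) : ℝ) : ℂ) := by
    push_cast
    exact Finset.sum_congr rfl fun k _ => by rw [← hφ k]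
  rw [this, Complex.norm_real, Finset.mul_sum]
  refine (Finset.sum_le_sum fun k _ => ?_).trans (le_abs_self _)
  rw [mul_comm]
  exact mul_le_mul_of_nonneg_left (hanti (Nat.sub_le n k)) (norm_nonneg _)

theorem IsMultiplier.summable_norm {p : ℝ} (hp : 0 < p) {φ : ℕ → ℂ} (hφ : IsMultiplier p φ)
    (hpos : ∀ k, φ k = (‖φ k‖ : ℂ)) : Summable fun k => ‖φ k‖ := by
  by_contra hns
  rw [not_summable_iff_tendsto_nat_atTop_of_nonneg fun k => norm_nonneg (φ k)] at hns
  have hb : Filter.Tendsto (fun n => (∑ k ∈ Finset.range (n + 1), ‖φ k‖₊) ^ p)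
      Filter.atTop Filter.atTop := by
    rw [← NNReal.tendsto_coe_atTop]
    simp only [NNReal.coe_rpow, NNReal.coe_sum, coe_nnnorm]
    exact (tendsto_rpow_atTop hp).comp (hns.comp (Filter.tendsto_add_atTop_nat 1))
  obtain ⟨g, hanti, hg, hgb⟩ := exists_antitone_summable_not_summable_mul hb
  have hroot : ∀ n, ((g n ^ p⁻¹ : NNReal) : ℝ) ^ p = g n := fun n => by
    rw [NNReal.coe_rpow, Real.rpow_inv_rpow (NNReal.coe_nonneg _) hp.ne']
  have hmem := hφ (fun n => (((g n ^ p⁻¹ : NNReal) : ℝ) : ℂ)) <| by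
    simp only [MemLpA, Complex.norm_real, NNReal.norm_eq, hroot]
    exact NNReal.summable_coe.2 hg
  refine hgb (NNReal.summable_coe.1 (hmem.of_nonneg_of_le (fun n => NNReal.coe_nonneg _) ?_))
  intro n
  have hanti' : Antitone fun n => ((g n ^ p⁻¹ : NNReal) : ℝ) := fun m n hmn =>
    NNReal.coe_le_coe.2 (NNReal.rpow_le_rpow (hanti hmn) (inv_nonneg.2 hp.le))
  have hS : 0 ≤ ∑ k ∈ Finset.range (n + 1), ‖φ k‖ := Finset.sum_nonneg fun _ _ => norm_nonneg _
  calc ((g n * (∑ k ∈ Finset.range (n + 1), ‖φ k‖₊) ^ p : NNReal) : ℝ)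
      = (((g n ^ p⁻¹ : NNReal) : ℝ) * ∑ k ∈ Finset.range (n + 1), ‖φ k‖) ^ p := by
        rw [Real.mul_rpow (NNReal.coe_nonneg _) hS, hroot]
        simp
    _ ≤ _ := Real.rpow_le_rpow (mul_nonneg (NNReal.coe_nonneg _) hS)
        (mul_sum_le_norm_cauchyMul hpos hanti' n) hp.le

/-- Testing a multiplier against the normalized indicator of an initial segment. -/
theorem IsMultiplier.average_le {p : ℝ} (hp : 0 < p) {φ : ℕ → ℂ} (hφ : IsMultiplier p φ)
    (hpos : ∀ k, φ k = (‖φ k‖ : ℂ)) {N : ℕ} (hN : N ≠ 0) :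
    ∃ f, MemLpA p f ∧ pNorm p f ≤ 1 ∧
      (N : ℝ)⁻¹ * ∑ n ∈ Finset.range N, (∑ k ∈ Finset.range (n + 1), ‖φ k‖) ^ p ≤
        pNorm p (cauchyMul φ f) ^ p := by
  set c : ℝ := ((N : ℝ)⁻¹) ^ p⁻¹
  have hc0 : 0 ≤ c := by positivity
  have hcp : c ^ p = (N : ℝ)⁻¹ := Real.rpow_inv_rpow (by positivity) hp.ne'
  set h : ℕ → ℝ := fun n => if n < N then c else 0 with hh
  have hanti : Antitone h := by
    intro m n hmn
    simp only [hh]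
    split_ifs with h1 h2
    · exact le_rfl
    · omega
    · exact hc0
    · exact le_rfl
  have hsum : HasSum (fun n => ‖((h n : ℝ) : ℂ)‖ ^ p) 1 := by
    have : (1 : ℝ) = ∑ n ∈ Finset.range N, ‖((h n : ℝ) : ℂ)‖ ^ p := by
      rw [Finset.sum_congr rfl (g := fun _ => (N : ℝ)⁻¹)]
      · simp [hN]
      · intro n hn
        rw [Complex.norm_real, hh]
        simp only [Finset.mem_range.1 hn, if_true]
        rw [Real.norm_of_nonneg hc0, hcp]
    rw [this]
    refine hasSum_sum_of_ne_finset_zero fun n hn => ?_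
    have : ¬ n < N := by simpa using hn
    simp [hh, this, hp.ne']
  have hmem : MemLpA p fun n => ((h n : ℝ) : ℂ) := hsum.summable
  refine ⟨fun n => ((h n : ℝ) : ℂ), hmem, ?_, ?_⟩
  · rw [pNorm, hsum.tsum_eq, Real.one_rpow]
  · rw [pNorm_rpow hp, Finset.mul_sum]
    refine (Finset.sum_le_sum fun n hn => ?_).trans
      ((hφ _ hmem).sum_le_tsum (Finset.range N) fun _ _ => Real.rpow_nonneg (norm_nonneg _) _)
    have hS : 0 ≤ ∑ k ∈ Finset.range (n + 1), ‖φ k‖ :=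
      Finset.sum_nonneg fun _ _ => norm_nonneg _
    have hle := mul_sum_le_norm_cauchyMul hpos hanti n
    have hn' : h n = c := if_pos (Finset.mem_range.1 hn)
    rw [hn'] at hle
    rw [← hcp, ← Real.mul_rpow hc0 hS]
    exact Real.rpow_le_rpow (mul_nonneg hc0 hS) hle hp.le

/-- A multiplier with nonnegative real coefficients lies in `ℓ¹_A`, and its `ℓ¹` norm equals
its multiplier norm. -/
theorem multiplier_nonneg_coeffs (p : ℝ) (hp : 1 < p) (φ : ℕ → ℂ) (hφ : IsMultiplier p φ)
    (hpos : ∀ k, (φ k).im = 0 ∧ 0 ≤ (φ k).re) :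
    Summable (fun k => ‖φ k‖) ∧ ∑' k, ‖φ k‖ = multNorm p φ := by
  have hp0 : 0 < p := by linarith
  have hpos' : ∀ k, φ k = (‖φ k‖ : ℂ) := fun k =>
    (Complex.eq_coe_norm_of_nonneg (Complex.nonneg_iff.2 ⟨(hpos k).2, (hpos k).1.symm⟩))
  have hsum := hφ.summable_norm hp0 hpos'
  have hA0 : 0 ≤ ∑' k, ‖φ k‖ := tsum_nonneg fun _ => norm_nonneg _
  have hub : ∀ x ∈ { x : ℝ | ∃ f : ℕ → ℂ, MemLpA p f ∧ pNorm p f ≤ 1 ∧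
      x = pNorm p (cauchyMul φ f) }, x ≤ ∑' k, ‖φ k‖ := by
    rintro x ⟨f, hf, hf1, rfl⟩
    exact (pNorm_cauchyMul_le hp hsum hf).trans (mul_le_of_le_one_right hA0 hf1)
  have hle : ∀ f, MemLpA p f → pNorm p f ≤ 1 → pNorm p (cauchyMul φ f) ≤ multNorm p φ :=
    fun f hf hf1 => le_csSup ⟨_, hub⟩ ⟨f, hf, hf1, rfl⟩
  have hm0 : 0 ≤ multNorm p φ := by
    obtain ⟨f, hf, hf1, -⟩ := hφ.average_le hp0 hpos' one_ne_zero
    exact (pNorm_nonneg _ _).trans (hle f hf hf1)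
  refine ⟨hsum, le_antisymm ?_ (Real.sSup_le hub hA0)⟩
  rw [← Real.rpow_le_rpow_iff hA0 hm0 hp0]
  have hlim := ((hsum.hasSum.tendsto_sum_nat.comp (Filter.tendsto_add_atTop_nat 1)).rpow_const
    (Or.inr hp0.le)).cesaro
  refine le_of_tendsto hlim ?_
  filter_upwards [Filter.eventually_ne_atTop 0] with N hN
  obtain ⟨f, hf, hf1, hav⟩ := hφ.average_le hp0 hpos' hN
  exact hav.trans (Real.rpow_le_rpow (pNorm_nonneg _ _) (hle f hf hf1) hp0.le)
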